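/- arXiv:2405.16586 — 7 statements merged into one kernel-verified Lean document; each statement's English description precedes it below -/
import Mathlib

section
/- A finite cubic simple graph with a bridge is not 3-edge-colorable. Precisely: if G is a finite cubic simple graph and S is a set of vertices of G such that exactly one edge of G is S-crossing, then G admits no proper 3-edge-coloring. -/
/-- A proper edge coloring of a simple graph `G` with colors in `C`:
any two distinct edges sharing an endpoint receive different colors. -/
def ProperEdgeColoring {V C : Type*} (G : SimpleGraph V) (κ : Sym2 V → C) : Prop :=
  ∀ e₁ ∈ G.edgeSet, ∀ e₂ ∈ G.edgeSet, e₁ ≠ e₂ → (∃ v, v ∈ e₁ ∧ v ∈ e₂) → κ e₁ ≠ κ e₂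

/-- The set of `S`-crossing edges of `G`: edges with exactly one endpoint in `S`. -/
def crossingEdges {V : Type*} (G : SimpleGraph V) (S : Set V) : Set (Sym2 V) :=
  {e | e ∈ G.edgeSet ∧ ∃ u v : V, e = s(u, v) ∧ u ∈ S ∧ v ∉ S}

/-- A finite set stable under a fixed-point-free involution has even cardinality. -/
theorem Finset.even_card_of_involutive {α : Type*} {f : α → α} (hf : Function.Involutive f)
    (hne : ∀ a, f a ≠ a) (s : Finset α) (hs : ∀ a ∈ s, f a ∈ s) : Even s.card := by
  have h : ∑ _a ∈ s, (1 : ZMod 2) = 0 :=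
    Finset.sum_involution (fun a _ => f a) (fun _ _ => by decide) (fun a _ _ => hne a)
      hs (fun a _ => hf a)
  rw [Finset.sum_const, nsmul_eq_mul, mul_one] at h
  exact (ZMod.natCast_eq_zero_iff_even).mp h

namespace ProperEdgeColoring

variable {V C : Type*} {G : SimpleGraph V} {κ : Sym2 V → C}

/-- Two neighbors of a vertex joined to it by edges of the same color are equal. -/
theorem eq_of_color_eq (hκ : ProperEdgeColoring G κ) {v w w' : V} (h : G.Adj v w)
    (h' : G.Adj v w') (hc : κ s(v, w) = κ s(v, w')) : w = w' := by
  by_contra hne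
  exact hκ s(v, w) h s(v, w') h' (fun he => hne (Sym2.congr_right.mp he))
    ⟨v, Sym2.mem_mk_left v w, Sym2.mem_mk_left v w'⟩ hc

/-- If the degree of `v` is the number of colors, every color occurs at `v`. -/
theorem exists_adj_color_eq [Fintype C] (hκ : ProperEdgeColoring G κ) (v : V)
    [Fintype (G.neighborSet v)] (hv : G.degree v = Fintype.card C) (c : C) :
    ∃ w, G.Adj v w ∧ κ s(v, w) = c := by
  classical
  have hinj : Set.InjOn (fun w => κ s(v, w)) (G.neighborFinset v) := fun w hw w' hw' h =>
    hκ.eq_of_color_eq (by simpa using hw) (by simpa using hw') h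
  have himage : (G.neighborFinset v).image (fun w => κ s(v, w)) = Finset.univ :=
    Finset.eq_univ_of_card _ (by rw [Finset.card_image_of_injOn hinj]; exact hv)
  have hc := Finset.mem_univ c
  rw [← himage] at hc
  simpa using hc

/-- If all degrees equal the number of colors, each color class is a perfect matching, given here
by the involution that swaps the ends of each of its edges. -/
theorem exists_involutive [Fintype C] [G.LocallyFinite] (hκ : ProperEdgeColoring G κ)
    (hG : ∀ v, G.degree v = Fintype.card C) (c : C) :
    ∃ f : V → V, Function.Involutive f ∧ ∀ v, G.Adj v (f v) ∧ κ s(v, f v) = c := by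
  choose f hf using fun v => hκ.exists_adj_color_eq v (hG v) c
  refine ⟨f, fun v => ?_, hf⟩
  refine hκ.eq_of_color_eq (hf (f v)).1 (hf v).1.symm ?_
  rw [(hf (f v)).2, Sym2.eq_swap, (hf v).2]

end ProperEdgeColoring

/-- A finite cubic simple graph with a bridge is not 3-edge-colorable: if `S` is a set of
vertices such that exactly one edge of `G` is `S`-crossing, then `G` admits no proper
3-edge-coloring. -/
theorem bridge_not_three_edge_colorable {V : Type*} [Fintype V] [DecidableEq V]
    (G : SimpleGraph V) [DecidableRel G.Adj]
    (hcubic : ∀ v : V, G.degree v = 3)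
    (S : Set V) (hbridge : (crossingEdges G S).ncard = 1) :
    ¬ ∃ κ : Sym2 V → Fin 3, ProperEdgeColoring G κ := by
  classical
  rintro ⟨κ, hκ⟩
  obtain ⟨e, he⟩ := Set.ncard_eq_one.mp hbridge
  obtain ⟨-, u, w, rfl, hu, hw⟩ : e ∈ crossingEdges G S := he ▸ Set.mem_singleton e
  have hcross {a b : V} (hab : G.Adj a b) (ha : a ∈ S) (hb : b ∉ S) : s(a, b) = s(u, w) := by
    have h : s(a, b) ∈ crossingEdges G S := ⟨hab, a, b, rfl, ha, hb⟩
    rwa [he] at h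
  have hG : ∀ v, G.degree v = Fintype.card (Fin 3) := by simpa using hcubic
  have huw : G.Adj u w := by
    have h : s(u, w) ∈ crossingEdges G S := he ▸ Set.mem_singleton _
    exact h.1
  have heven : Even S.toFinset.card := by
    obtain ⟨c, hc⟩ := exists_ne (κ s(u, w))
    obtain ⟨f, hf, hfc⟩ := hκ.exists_involutive hG c
    refine Finset.even_card_of_involutive hf (fun a => (hfc a).1.ne') _ fun a ha => ?_
    rw [Set.mem_toFinset] at ha ⊢
    by_contra hfa
    exact hc (by rw [← (hfc a).2, hcross (hfc a).1 ha hfa])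
  have herase : Even (S.toFinset.erase u).card := by
    obtain ⟨f, hf, hfc⟩ := hκ.exists_involutive hG (κ s(u, w))
    have hfu : f u = w := hκ.eq_of_color_eq (hfc u).1 huw (hfc u).2
    refine Finset.even_card_of_involutive hf (fun a => (hfc a).1.ne') _ fun a ha => ?_
    rw [Finset.mem_erase, Set.mem_toFinset] at ha ⊢
    refine ⟨fun hfa => hw ?_, ?_⟩
    · rw [← hfu, ← hfa, hf a]
      exact ha.2
    · by_contra hfa
      rcases Sym2.eq_iff.mp (hcross (hfc a).1 ha.2 hfa) with h | h
      · exact ha.1 h.1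
      · exact hw (h.1 ▸ ha.2)
  have hcard := Finset.card_erase_add_one (Set.mem_toFinset.mpr hu)
  rw [← hcard, Nat.even_add_one] at heven
  exact heven herase
end

section
/- Let G be a finite cubic simple graph and A a set of vertices of G such that exactly two edges of G are A-crossing, say a₁b₁ and a₂b₂ with a₁, a₂ ∈ A distinct and b₁, b₂ ∉ A distinct, and suppose that a₁a₂ is not an edge of G and b₁b₂ is not an edge of G. Let G_A be the simple graph on the vertex set A whose edges are all edges of G with both endpoints in A together with one new edge a₁a₂, and let G_B be defined analogously on the complement of A with new edge b₁b₂. Then G is 3-edge-colorable if and only if both G_A and G_B are 3-edge-colorable. -/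
/-- A simple graph is 3-edge-colorable if it admits a proper 3-edge-coloring. -/
def ThreeEdgeColorable {V : Type*} (G : SimpleGraph V) : Prop :=
  ∃ κ : Sym2 V → Fin 3, ProperEdgeColoring G κ

theorem properEdgeColoring_iff {V C : Type*} {G : SimpleGraph V} {κ : Sym2 V → C} :
    ProperEdgeColoring G κ ↔
      ∀ v u w, G.Adj v u → G.Adj v w → u ≠ w → κ s(v, u) ≠ κ s(v, w) := by
  constructor
  · intro h v u w hu hw huw
    exact h _ hu _ hw (fun h => huw (Sym2.congr_right.1 h)) ⟨v, by simp, by simp⟩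
  · rintro h e₁ h₁ e₂ h₂ hne ⟨v, hv₁, hv₂⟩
    obtain ⟨u, rfl⟩ := hv₁
    obtain ⟨w, rfl⟩ := hv₂
    exact h v u w h₁ h₂ (by rintro rfl; exact hne rfl)

/-- Adjacency in the graph induced on `A` with the extra edge `xy`. -/
theorem fromEdgeSet_side_adj {V : Type*} (G : SimpleGraph V) (A : Set V) {x y : V}
    (hxy : x ≠ y) (u v : V) :
    (SimpleGraph.fromEdgeSet ({e | e ∈ G.edgeSet ∧ ∀ v ∈ e, v ∈ A} ∪ {s(x, y)})).Adj u v ↔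
      (G.Adj u v ∧ u ∈ A ∧ v ∈ A) ∨ (u = x ∧ v = y) ∨ (u = y ∧ v = x) := by
  have := G.ne_of_adj (a := u) (b := v)
  simp only [SimpleGraph.fromEdgeSet_adj, Set.mem_union, Set.mem_ofPred_eq,
    SimpleGraph.mem_edgeSet, Sym2.mem_iff, Set.mem_singleton_iff, Sym2.eq_iff,
    forall_eq_or_imp, forall_eq]
  grind

/-- In a cubic graph with a proper 3-edge-coloring, every color appears at every vertex. -/
theorem ProperEdgeColoring.exists_adj_color {V : Type*} [Fintype V] {G : SimpleGraph V}
    [DecidableRel G.Adj] {κ : Sym2 V → Fin 3} (hκ : ProperEdgeColoring G κ) {v : V}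
    (hv : G.degree v = 3) (c : Fin 3) : ∃ u, G.Adj v u ∧ κ s(v, u) = c := by
  rw [properEdgeColoring_iff] at hκ
  have hinj : Set.InjOn (fun u => κ s(v, u)) (G.neighborFinset v) := by
    intro u hu w hw h
    by_contra hne
    exact hκ v u w (by simpa using hu) (by simpa using hw) hne h
  have himg : (G.neighborFinset v).image (fun u => κ s(v, u)) = Finset.univ := by
    rw [← Finset.card_eq_iff_eq_univ, Finset.card_image_of_injOn hinj,
      SimpleGraph.card_neighborFinset_eq_degree, hv, Fintype.card_fin]
  simpa using himg.ge (Finset.mem_univ c)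

/-- A vertex set that no edge of color `c` leaves is matched by color `c`, hence even. -/
theorem ProperEdgeColoring.even_card {V : Type*} [Fintype V] {G : SimpleGraph V}
    [DecidableRel G.Adj] {κ : Sym2 V → Fin 3} (hκ : ProperEdgeColoring G κ)
    (hcubic : ∀ v, G.degree v = 3) (c : Fin 3) (S : Finset V)
    (hS : ∀ v ∈ S, ∀ u, G.Adj v u → κ s(v, u) = c → u ∈ S) : Even S.card := by
  choose m hm hmc using fun v => hκ.exists_adj_color (hcubic v) c
  rw [properEdgeColoring_iff] at hκ
  have hsum : ∑ _x ∈ S, (1 : ZMod 2) = 0 := by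
    refine Finset.sum_involution (fun v _ => m v) (fun _ _ => by decide)
      (fun v _ _ => (hm v).ne') (fun v hv => hS v hv _ (hm v) (hmc v)) (fun v _ => ?_)
    by_contra hne
    refine hκ (m v) (m (m v)) v (hm _) (hm v).symm hne ?_
    rw [hmc, Sym2.eq_swap, hmc]
  rw [even_iff_two_dvd, ← ZMod.natCast_eq_zero_iff]
  simpa using hsum

/-- The two edges of a 2-edge-cut in a cubic graph get the same color. -/
theorem ProperEdgeColoring.cut_edges_color_eq {V : Type*} [Fintype V] {G : SimpleGraph V}
    [DecidableRel G.Adj] {κ : Sym2 V → Fin 3} (hκ : ProperEdgeColoring G κ)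
    (hcubic : ∀ v, G.degree v = 3) {A : Set V} {a₁ a₂ b₁ b₂ : V} (ha₁ : a₁ ∈ A)
    (he₁ : G.Adj a₁ b₁)
    (hcut : ∀ u v, G.Adj u v → u ∈ A → v ∉ A → (u = a₁ ∧ v = b₁) ∨ (u = a₂ ∧ v = b₂))
    (hb₁ : b₁ ∉ A) : κ s(a₁, b₁) = κ s(a₂, b₂) := by
  classical
  by_contra hne
  obtain ⟨c, hc₁, hc₂⟩ : ∃ c : Fin 3, c ≠ κ s(a₁, b₁) ∧ c ≠ κ s(a₂, b₂) := by
    generalize κ s(a₁, b₁) = x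
    generalize κ s(a₂, b₂) = y
    revert x y
    decide
  have hA : Even A.toFinset.card := by
    refine hκ.even_card hcubic c _ fun v hv u hvu hcol => ?_
    rw [Set.mem_toFinset] at hv ⊢
    by_contra hu
    grind
  have hA' : Even (A.toFinset.erase a₁).card := by
    refine hκ.even_card hcubic (κ s(a₁, b₁)) _ fun v hv u hvu hcol => ?_
    rw [Finset.mem_erase, Set.mem_toFinset] at hv ⊢
    constructor
    · rintro rfl
      refine properEdgeColoring_iff.1 hκ u v b₁ hvu.symm he₁ ?_ (by rw [Sym2.eq_swap, hcol])
      rintro rfl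
      exact hb₁ hv.2
    · by_contra hu
      grind
  have hcard := Finset.card_erase_add_one (Set.mem_toFinset.2 ha₁)
  grind

/-- A coloring giving both cut edges the same color restricts to one side of the cut. -/
theorem ProperEdgeColoring.threeEdgeColorable_side {V : Type*} {G : SimpleGraph V}
    {κ : Sym2 V → Fin 3} (hκ : ProperEdgeColoring G κ) {A : Set V} {a₁ a₂ b₁ b₂ : V}
    (hb₁ : b₁ ∉ A) (hb₂ : b₂ ∉ A) (ha : a₁ ≠ a₂)
    (he₁ : G.Adj a₁ b₁) (he₂ : G.Adj a₂ b₂)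
    (heq : κ s(a₁, b₁) = κ s(a₂, b₂)) :
    ThreeEdgeColorable (SimpleGraph.fromEdgeSet
      ({e | e ∈ G.edgeSet ∧ ∀ v ∈ e, v ∈ A} ∪ {s(a₁, a₂)})) := by
  classical
  rw [properEdgeColoring_iff] at hκ
  refine ⟨fun e => if e = s(a₁, a₂) then κ s(a₁, b₁) else κ e,
    properEdgeColoring_iff.2 fun v u w hu hw huw => ?_⟩
  rw [fromEdgeSet_side_adj G A ha] at hu hw
  have h₁ := fun u hu => hκ a₁ u b₁ hu he₁
  have h₂ := fun u hu => hκ a₂ u b₂ hu he₂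
  have h₃ := hκ v u w
  simp only [Sym2.eq_iff]
  grind

/-- A coloring of `G` that agrees near `A` with a proper coloring of the reduced graph on `A`,
the cut edges getting the color of the new edge, is proper at the vertices of `A`. -/
theorem ProperEdgeColoring.proper_at_of_side {V C : Type*} {G : SimpleGraph V} {A : Set V}
    {a₁ a₂ b₁ b₂ : V} {κ' κ : Sym2 V → C}
    (hκ' : ProperEdgeColoring (SimpleGraph.fromEdgeSet
      ({e | e ∈ G.edgeSet ∧ ∀ v ∈ e, v ∈ A} ∪ {s(a₁, a₂)})) κ')
    (ha : a₁ ≠ a₂) (hna : ¬ G.Adj a₁ a₂)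
    (hcut : ∀ u v, G.Adj u v → u ∈ A → v ∉ A → (u = a₁ ∧ v = b₁) ∨ (u = a₂ ∧ v = b₂))
    (hin : ∀ u v, u ∈ A → v ∈ A → κ s(u, v) = κ' s(u, v))
    (hout : ∀ u v, u ∈ A → v ∉ A → κ s(u, v) = κ' s(a₁, a₂))
    {v u w : V} (hv : v ∈ A) (hu : G.Adj v u) (hw : G.Adj v w) (huw : u ≠ w) :
    κ s(v, u) ≠ κ s(v, w) := by
  rw [properEdgeColoring_iff] at hκ'
  simp only [fromEdgeSet_side_adj G A ha] at hκ'
  have h₁ := hκ' a₁ a₂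
  have h₂ := hκ' a₂ a₁
  have h₃ := hκ' v u w
  have h₄ := G.adj_comm a₁ a₂
  have h₅ : s(a₁, a₂) = s(a₂, a₁) := Sym2.eq_swap
  by_cases hu' : u ∈ A <;> by_cases hw' : w ∈ A <;> grind

theorem ProperEdgeColoring.comp_injective {V C D : Type*} {G : SimpleGraph V} {κ : Sym2 V → C}
    (hκ : ProperEdgeColoring G κ) {f : C → D} (hf : Function.Injective f) :
    ProperEdgeColoring G (f ∘ κ) :=
  fun e₁ h₁ e₂ h₂ hne hv h => hκ e₁ h₁ e₂ h₂ hne hv (hf h)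

/-- 2-edge-cut reduction: let `G` be a finite cubic simple graph and `A` a set of vertices
such that exactly the two edges `a₁b₁`, `a₂b₂` of `G` are `A`-crossing (with `a₁, a₂ ∈ A`
distinct, `b₁, b₂ ∉ A` distinct, `a₁a₂` and `b₁b₂` not edges of `G`).  Let `G_A` consist of
all edges of `G` with both endpoints in `A` together with the new edge `a₁a₂`, and `G_B` be
the analogue on the complement of `A` with the new edge `b₁b₂`.  Then `G` is 3-edge-colorable
iff both `G_A` and `G_B` are. -/
theorem two_edge_cut_reduction {V : Type*} [Fintype V] [DecidableEq V]
    (G : SimpleGraph V) [DecidableRel G.Adj]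
    (hcubic : ∀ v : V, G.degree v = 3)
    (A : Set V) (a₁ a₂ b₁ b₂ : V)
    (ha₁ : a₁ ∈ A) (ha₂ : a₂ ∈ A) (hb₁ : b₁ ∉ A) (hb₂ : b₂ ∉ A)
    (ha : a₁ ≠ a₂) (hb : b₁ ≠ b₂)
    (he₁ : G.Adj a₁ b₁) (he₂ : G.Adj a₂ b₂)
    (hcross : crossingEdges G A = {s(a₁, b₁), s(a₂, b₂)})
    (hna : ¬ G.Adj a₁ a₂) (hnb : ¬ G.Adj b₁ b₂) :
    ThreeEdgeColorable G ↔
      (ThreeEdgeColorable (SimpleGraph.fromEdgeSet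
          ({e | e ∈ G.edgeSet ∧ ∀ v ∈ e, v ∈ A} ∪ {s(a₁, a₂)})) ∧
       ThreeEdgeColorable (SimpleGraph.fromEdgeSet
          ({e | e ∈ G.edgeSet ∧ ∀ v ∈ e, v ∉ A} ∪ {s(b₁, b₂)}))) := by
  have hcut : ∀ u v, G.Adj u v → u ∈ A → v ∉ A →
      (u = a₁ ∧ v = b₁) ∨ (u = a₂ ∧ v = b₂) := by
    intro u v huv hu hv
    have hmem : s(u, v) ∈ crossingEdges G A := ⟨huv, u, v, rfl, hu, hv⟩
    rw [hcross] at hmem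
    simp only [Set.mem_insert_iff, Set.mem_singleton_iff, Sym2.eq_iff] at hmem
    grind
  have hcut' : ∀ u v, G.Adj u v → u ∈ Aᶜ → v ∉ Aᶜ →
      (u = b₁ ∧ v = a₁) ∨ (u = b₂ ∧ v = a₂) := by
    intro u v huv hu hv
    exact (hcut v u huv.symm (not_not.1 hv) hu).imp And.symm And.symm
  constructor
  · rintro ⟨κ, hκ⟩
    have heq := hκ.cut_edges_color_eq hcubic ha₁ he₁ hcut hb₁
    refine ⟨hκ.threeEdgeColorable_side hb₁ hb₂ ha he₁ he₂ heq, ?_⟩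
    refine hκ.threeEdgeColorable_side (A := Aᶜ) (not_not.2 ha₁) (not_not.2 ha₂) hb he₁.symm
      he₂.symm ?_
    rw [Sym2.eq_swap, heq, Sym2.eq_swap]
  · rintro ⟨⟨κA, hκA⟩, ⟨κB₀, hκB₀⟩⟩
    obtain ⟨κB, hκB, hAB⟩ : ∃ κB : Sym2 V → Fin 3, ProperEdgeColoring (SimpleGraph.fromEdgeSet
        ({e | e ∈ G.edgeSet ∧ ∀ v ∈ e, v ∈ Aᶜ} ∪ {s(b₁, b₂)})) κB ∧
        κB s(b₁, b₂) = κA s(a₁, a₂) :=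
      ⟨_, hκB₀.comp_injective (Equiv.swap (κB₀ s(b₁, b₂)) (κA s(a₁, a₂))).injective,
        Equiv.swap_apply_left _ _⟩
    classical
    let κ : Sym2 V → Fin 3 := fun e =>
      if ∀ v ∈ e, v ∈ A then κA e else if ∀ v ∈ e, v ∉ A then κB e else κA s(a₁, a₂)
    refine ⟨κ, properEdgeColoring_iff.2 fun v u w hu hw huw => ?_⟩
    by_cases hv : v ∈ A
    · refine hκA.proper_at_of_side ha hna hcut ?_ ?_ hv hu hw huw
      · intro u v hu hv
        simp [κ, hu, hv]
      · intro u v hu hv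
        simp [κ, hu, hv]
    · refine hκB.proper_at_of_side hb hnb hcut' ?_ ?_ hv hu hw huw
      · intro u v hu hv
        rw [Set.mem_compl_iff] at hu hv
        simp [κ, hu, hv]
      · intro u v hu hv
        rw [Set.mem_compl_iff] at hu hv
        simp [κ, hu, not_not.1 hv, hAB]
end

section
/- Let G be a finite cubic simple graph and A a set of vertices of G such that exactly three edges of G are A-crossing, say a₁b₁, a₂b₂, a₃b₃ with a₁, a₂, a₃ ∈ A pairwise distinct and b₁, b₂, b₃ ∉ A pairwise distinct. Let G_A be the simple graph obtained from the subgraph of G induced on A by adding one new vertex adjacent exactly to a₁, a₂ and a₃, and let G_B be defined analogously on the complement of A with a new vertex adjacent exactly to b₁, b₂ and b₃. Then G is 3-edge-colorable if and only if both G_A and G_B are 3-edge-colorable. -/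
theorem threeEdgeColorable_iff {V : Type*} (G : SimpleGraph V) :
    ThreeEdgeColorable G ↔ ∃ c : V → V → Fin 3, (∀ u v, c u v = c v u) ∧
      ∀ v u w, G.Adj v u → G.Adj v w → u ≠ w → c v u ≠ c v w := by
  constructor
  · rintro ⟨κ, hκ⟩
    refine ⟨fun u v => κ s(u, v), fun u v => congrArg κ Sym2.eq_swap, fun v u w hu hw huw => ?_⟩
    exact hκ _ hu _ hw (fun h => huw (Sym2.congr_right.1 h)) ⟨v, by simp, by simp⟩
  · rintro ⟨c, hc, hp⟩
    refine ⟨fun e => Sym2.lift ⟨c, hc⟩ e, ?_⟩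
    rintro e₁ h₁ e₂ h₂ hne ⟨v, hv₁, hv₂⟩
    obtain ⟨u, rfl⟩ := hv₁
    obtain ⟨w, rfl⟩ := hv₂
    exact hp v u w h₁ h₂ fun h => hne (by rw [h])

/-- The graph obtained from the subgraph of `G` induced on `S` by adding a new vertex `none`
adjacent to the vertices `a i`. -/
def capGraph {V ι : Type*} (G : SimpleGraph V) (S : Set V) (a : ι → V) :
    SimpleGraph (Option V) :=
  SimpleGraph.fromEdgeSet
    ({e : Sym2 (Option V) | ∃ u v : V, e = s(some u, some v) ∧ G.Adj u v ∧ u ∈ S ∧ v ∈ S}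
      ∪ Set.range fun i => s((none : Option V), some (a i)))

section capGraph

variable {V ι : Type*} {G : SimpleGraph V} {S : Set V} {a : ι → V} {u v : V}

theorem capGraph_adj_some_some :
    (capGraph G S a).Adj (some u) (some v) ↔ G.Adj u v ∧ u ∈ S ∧ v ∈ S := by
  simp only [capGraph, SimpleGraph.fromEdgeSet_adj, Set.mem_union, Set.mem_ofPred_eq,
    Set.mem_range, Sym2.eq_iff]
  constructor
  · rintro ⟨⟨x, y, h | h, hxy, hx, hy⟩ | ⟨i, h | h⟩, -⟩ <;> simp_all [G.adj_comm]
  · rintro ⟨h, hu, hv⟩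
    exact ⟨Or.inl ⟨u, v, by simp, h, hu, hv⟩, by simpa using h.ne⟩

theorem capGraph_adj_none_some : (capGraph G S a).Adj none (some u) ↔ ∃ i, u = a i := by
  simp [capGraph, eq_comm]

theorem capGraph_adj_some_none : (capGraph G S a).Adj (some u) none ↔ ∃ i, u = a i := by
  rw [SimpleGraph.adj_comm, capGraph_adj_none_some]

end capGraph

section

variable {V : Type*} {G : SimpleGraph V} {S : Set V} {a b : Fin 3 → V}

/-- The parity lemma: the edges of a 3-edge-cut of a cubic graph get distinct colors. -/
theorem injective_color_of_cut [Fintype V] [DecidableRel G.Adj]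
    (hcubic : ∀ v, G.degree v = 3) (ha : Function.Injective a)
    (hcut : ∀ u v, u ∈ S → v ∉ S → (G.Adj u v ↔ ∃ i, u = a i ∧ v = b i))
    (haS : ∀ i, a i ∈ S) (hbS : ∀ i, b i ∉ S)
    {c : V → V → Fin 3} (hc : ∀ u v, c u v = c v u)
    (hp : ∀ v u w, G.Adj v u → G.Adj v w → u ≠ w → c v u ≠ c v w) :
    Function.Injective fun i => c (a i) (b i) := by
  classical
  let φ : Fin 3 → ZMod 2 × ZMod 2 := ![(1, 0), (0, 1), (1, 1)]
  have vertex_sum (v : V) : ∑ u, (if G.Adj v u then φ (c v u) else 0) = 0 := by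
    rw [← Finset.sum_filter, ← G.neighborFinset_eq_filter]
    have hinj : Set.InjOn (c v) (G.neighborFinset v) := by
      intro x hx y hy hxy
      by_contra hne
      exact hp v x y (by simpa using hx) (by simpa using hy) hne hxy
    rw [← Finset.sum_image (f := φ) hinj]
    have himage : (G.neighborFinset v).image (c v) = Finset.univ := by
      rw [← Finset.card_eq_iff_eq_univ, Finset.card_image_of_injOn hinj,
        G.card_neighborFinset_eq_degree, hcubic, Fintype.card_fin]
    rw [himage]
    decide
  have inside : ∑ p : V × V with p.1 ∈ S ∧ p.2 ∈ S,
      (if G.Adj p.1 p.2 then φ (c p.1 p.2) else 0) = 0 := by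
    refine Finset.sum_involution (fun p _ => p.swap) ?_ ?_ ?_ ?_
    · rintro ⟨u, v⟩ -
      simp only [Prod.swap, G.adj_comm v u, hc v u]
      exact CharTwo.add_self_eq_zero _
    · rintro ⟨u, v⟩ - h heq
      simp only [Prod.swap, Prod.mk.injEq] at heq
      simp [heq.1] at h
    · rintro ⟨u, v⟩ h
      simpa [and_comm] using h
    · simp
  have outside : ∑ p : V × V with p.1 ∈ S ∧ p.2 ∉ S,
      (if G.Adj p.1 p.2 then φ (c p.1 p.2) else 0) = ∑ i, φ (c (a i) (b i)) := by
    rw [← Finset.sum_filter, Finset.filter_filter]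
    symm
    refine Finset.sum_bij (fun i _ => (a i, b i)) ?_ ?_ ?_ ?_
    · intro i _
      simpa [haS, hbS] using (hcut _ _ (haS i) (hbS i)).2 ⟨i, rfl, rfl⟩
    · intro i _ j _ h
      exact ha (Prod.mk.inj h).1
    · rintro ⟨u, v⟩ h
      simp only [Finset.mem_filter, Finset.mem_univ, true_and] at h
      obtain ⟨i, rfl, rfl⟩ := (hcut u v h.1.1 h.1.2).1 h.2
      exact ⟨i, Finset.mem_univ _, rfl⟩
    · simp
  have total : ∑ i, φ (c (a i) (b i)) = 0 := by
    rw [← outside, ← zero_add (Finset.sum _ _)]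
    nth_rw 1 [← inside]
    rw [← Finset.filter_filter, ← Finset.filter_filter, Finset.sum_filter_add_sum_filter_not, Finset.sum_filter,
      Fintype.sum_prod_type]
    refine Finset.sum_eq_zero fun v _ => ?_
    by_cases hv : v ∈ S
    · simpa [hv] using vertex_sum v
    · simp [hv]
  have sum_zero : ∀ x y z : Fin 3, φ x + φ y + φ z = 0 → x ≠ y ∧ x ≠ z ∧ y ≠ z := by decide
  rw [Fin.sum_univ_three] at total
  obtain ⟨h01, h02, h12⟩ := sum_zero _ _ _ total
  intro i j hij
  fin_cases i <;> fin_cases j <;> simp_all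

theorem threeEdgeColorable_capGraph (ha : Function.Injective a)
    (hab : ∀ i, G.Adj (a i) (b i)) (hbS : ∀ i, b i ∉ S)
    {c : V → V → Fin 3} (hc : ∀ u v, c u v = c v u)
    (hp : ∀ v u w, G.Adj v u → G.Adj v w → u ≠ w → c v u ≠ c v w)
    (hinj : Function.Injective fun i => c (a i) (b i)) :
    ThreeEdgeColorable (capGraph G S a) := by
  let d (u : V) : Fin 3 := Function.extend a (fun i => c (a i) (b i)) (fun _ => 0) u
  have hd (i : Fin 3) : d (a i) = c (a i) (b i) := ha.extend_apply _ _ i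
  let c' : Option V → Option V → Fin 3
    | some u, some v => c u v
    | some u, none => d u
    | none, some u => d u
    | none, none => 0
  refine (threeEdgeColorable_iff _).2 ⟨c', ?_, ?_⟩
  · rintro (_ | u) (_ | v)
    exacts [rfl, rfl, rfl, hc u v]
  · rintro (_ | v) (_ | u) (_ | w) hu hw hne
    · exact absurd rfl hne
    · exact absurd hu (SimpleGraph.irrefl _)
    · exact absurd hw (SimpleGraph.irrefl _)
    · obtain ⟨i, rfl⟩ := capGraph_adj_none_some.1 hu
      obtain ⟨j, rfl⟩ := capGraph_adj_none_some.1 hw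
      change d (a i) ≠ d (a j)
      rw [hd, hd]
      exact fun h => hne (by rw [hinj h])
    · exact absurd rfl hne
    · obtain ⟨i, rfl⟩ := capGraph_adj_some_none.1 hu
      obtain ⟨hw, -, hwS⟩ := capGraph_adj_some_some.1 hw
      change d (a i) ≠ c (a i) w
      rw [hd]
      exact hp _ _ _ (hab i) hw fun h => hbS i (h ▸ hwS)
    · obtain ⟨i, rfl⟩ := capGraph_adj_some_none.1 hw
      obtain ⟨hu, -, huS⟩ := capGraph_adj_some_some.1 hu
      change c (a i) u ≠ d (a i)
      rw [hd]
      exact hp _ _ _ hu (hab i) fun h => hbS i (h ▸ huS)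
    · exact hp v u w (capGraph_adj_some_some.1 hu).1 (capGraph_adj_some_some.1 hw).1
        fun h => hne (by rw [h])

theorem threeEdgeColorable_of_capGraph
    (ha : Function.Injective a) (hb : Function.Injective b)
    (hcut : ∀ u v, u ∈ S → v ∉ S → (G.Adj u v ↔ ∃ i, u = a i ∧ v = b i))
    (hA : ThreeEdgeColorable (capGraph G S a)) (hB : ThreeEdgeColorable (capGraph G Sᶜ b)) :
    ThreeEdgeColorable G := by
  classical
  obtain ⟨c, hc, hp⟩ := (threeEdgeColorable_iff _).1 hA
  obtain ⟨d, hd, hq⟩ := (threeEdgeColorable_iff _).1 hB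
  have hcinj : Function.Injective fun i => c none (some (a i)) := by
    intro i j h
    by_contra hne
    exact hp _ _ _ (capGraph_adj_none_some.2 ⟨i, rfl⟩) (capGraph_adj_none_some.2 ⟨j, rfl⟩)
      (fun h' => hne (ha (Option.some.inj h'))) h
  have hdinj : Function.Injective fun i => d none (some (b i)) := by
    intro i j h
    by_contra hne
    exact hq _ _ _ (capGraph_adj_none_some.2 ⟨i, rfl⟩) (capGraph_adj_none_some.2 ⟨j, rfl⟩)
      (fun h' => hne (hb (Option.some.inj h'))) h
  obtain ⟨σ, hσ⟩ : ∃ σ : Equiv.Perm (Fin 3), ∀ i,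
      σ (d none (some (b i))) = c none (some (a i)) := by
    let e := Equiv.ofBijective _ (Finite.injective_iff_bijective.1 hdinj)
    let f := Equiv.ofBijective _ (Finite.injective_iff_bijective.1 hcinj)
    exact ⟨e.symm.trans f, fun i => congrArg f (e.symm_apply_apply i)⟩
  let κ (u v : V) : Fin 3 :=
    if u ∈ S then if v ∈ S then c (some u) (some v) else c none (some u)
    else if v ∈ S then c none (some v) else σ (d (some u) (some v))
  refine (threeEdgeColorable_iff _).2 ⟨κ, fun u v => ?_, fun v u w hu hw hne => ?_⟩
  · simp only [κ, hc (some u) (some v), hd (some u) (some v)]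
    split_ifs <;> rfl
  by_cases hvS : v ∈ S <;> by_cases huS : u ∈ S <;> by_cases hwS : w ∈ S <;>
    simp only [κ, hvS, huS, hwS, if_true, if_false]
  · exact hp _ _ _ (capGraph_adj_some_some.2 ⟨hu, hvS, huS⟩)
      (capGraph_adj_some_some.2 ⟨hw, hvS, hwS⟩) (by simpa using hne)
  · obtain ⟨i, rfl, rfl⟩ := (hcut _ _ hvS hwS).1 hw
    rw [hc none]
    exact hp _ _ _ (capGraph_adj_some_some.2 ⟨hu, hvS, huS⟩)
      (capGraph_adj_some_none.2 ⟨i, rfl⟩) (by simp)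
  · obtain ⟨i, rfl, rfl⟩ := (hcut _ _ hvS huS).1 hu
    rw [hc none]
    exact hp _ _ _ (capGraph_adj_some_none.2 ⟨i, rfl⟩)
      (capGraph_adj_some_some.2 ⟨hw, hvS, hwS⟩) (by simp)
  · obtain ⟨i, rfl, rfl⟩ := (hcut _ _ hvS huS).1 hu
    obtain ⟨j, hij, rfl⟩ := (hcut _ _ hvS hwS).1 hw
    exact absurd (by rw [ha hij]) hne
  · obtain ⟨i, rfl, rfl⟩ := (hcut _ _ huS hvS).1 hu.symm
    obtain ⟨j, rfl, hij⟩ := (hcut _ _ hwS hvS).1 hw.symm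
    exact absurd (by rw [hb hij]) hne
  · obtain ⟨i, rfl, rfl⟩ := (hcut _ _ huS hvS).1 hu.symm
    rw [← hσ, σ.injective.ne_iff, hd none]
    exact hq _ _ _ (capGraph_adj_some_none.2 ⟨i, rfl⟩)
      (capGraph_adj_some_some.2 ⟨hw, hvS, hwS⟩) (by simp)
  · obtain ⟨i, rfl, rfl⟩ := (hcut _ _ hwS hvS).1 hw.symm
    rw [← hσ, σ.injective.ne_iff, hd none]
    exact hq _ _ _ (capGraph_adj_some_some.2 ⟨hu, hvS, huS⟩)
      (capGraph_adj_some_none.2 ⟨i, rfl⟩) (by simp)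
  · rw [σ.injective.ne_iff]
    exact hq _ _ _ (capGraph_adj_some_some.2 ⟨hu, hvS, huS⟩)
      (capGraph_adj_some_some.2 ⟨hw, hvS, hwS⟩) (by simpa using hne)

/-- The 3-edge-cut reduction with the cut edges indexed by `Fin 3`. -/
theorem threeEdgeColorable_iff_capGraph [Fintype V] [DecidableRel G.Adj]
    (hcubic : ∀ v, G.degree v = 3)
    (ha : Function.Injective a) (hb : Function.Injective b)
    (hcut : ∀ u v, u ∈ S → v ∉ S → (G.Adj u v ↔ ∃ i, u = a i ∧ v = b i))
    (haS : ∀ i, a i ∈ S) (hbS : ∀ i, b i ∉ S) :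
    ThreeEdgeColorable G ↔
      ThreeEdgeColorable (capGraph G S a) ∧ ThreeEdgeColorable (capGraph G Sᶜ b) := by
  refine ⟨fun h => ?_, fun h => threeEdgeColorable_of_capGraph ha hb hcut h.1 h.2⟩
  obtain ⟨c, hc, hp⟩ := (threeEdgeColorable_iff G).1 h
  have hab (i : Fin 3) : G.Adj (a i) (b i) := (hcut _ _ (haS i) (hbS i)).2 ⟨i, rfl, rfl⟩
  have hinj := injective_color_of_cut hcubic ha hcut haS hbS hc hp
  refine ⟨threeEdgeColorable_capGraph ha hab hbS hc hp hinj,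
    threeEdgeColorable_capGraph hb (fun i => (hab i).symm) (fun i => not_not.2 (haS i)) hc hp ?_⟩
  simpa only [hc (b _)] using hinj

end

/-- 3-edge-cut reduction: let `G` be a finite cubic simple graph and `A` a set of vertices
such that exactly the three edges `a₁b₁`, `a₂b₂`, `a₃b₃` of `G` are `A`-crossing (with
`a₁, a₂, a₃ ∈ A` pairwise distinct and `b₁, b₂, b₃ ∉ A` pairwise distinct).  Let `G_A` be
obtained from the subgraph of `G` induced on `A` by adding a new vertex (`none`) adjacent
exactly to `a₁, a₂, a₃`, and let `G_B` be the analogue on the complement of `A` with a new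
vertex adjacent exactly to `b₁, b₂, b₃`.  Then `G` is 3-edge-colorable iff both `G_A` and
`G_B` are. -/
theorem three_edge_cut_reduction {V : Type*} [Fintype V] [DecidableEq V]
    (G : SimpleGraph V) [DecidableRel G.Adj]
    (hcubic : ∀ v : V, G.degree v = 3)
    (A : Set V) (a₁ a₂ a₃ b₁ b₂ b₃ : V)
    (ha₁ : a₁ ∈ A) (ha₂ : a₂ ∈ A) (ha₃ : a₃ ∈ A)
    (hb₁ : b₁ ∉ A) (hb₂ : b₂ ∉ A) (hb₃ : b₃ ∉ A)
    (ha12 : a₁ ≠ a₂) (ha13 : a₁ ≠ a₃) (ha23 : a₂ ≠ a₃)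
    (hb12 : b₁ ≠ b₂) (hb13 : b₁ ≠ b₃) (hb23 : b₂ ≠ b₃)
    (he₁ : G.Adj a₁ b₁) (he₂ : G.Adj a₂ b₂) (he₃ : G.Adj a₃ b₃)
    (hcross : crossingEdges G A = {s(a₁, b₁), s(a₂, b₂), s(a₃, b₃)}) :
    ThreeEdgeColorable G ↔
      (ThreeEdgeColorable (SimpleGraph.fromEdgeSet
          ({e : Sym2 (Option V) |
              ∃ u v : V, e = s(some u, some v) ∧ G.Adj u v ∧ u ∈ A ∧ v ∈ A}
            ∪ {s((none : Option V), some a₁), s((none : Option V), some a₂),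
                s((none : Option V), some a₃)})) ∧
       ThreeEdgeColorable (SimpleGraph.fromEdgeSet
          ({e : Sym2 (Option V) |
              ∃ u v : V, e = s(some u, some v) ∧ G.Adj u v ∧ u ∉ A ∧ v ∉ A}
            ∪ {s((none : Option V), some b₁), s((none : Option V), some b₂),
                s((none : Option V), some b₃)}))) := by
  have hinj {x y z : V} (hxy : x ≠ y) (hxz : x ≠ z) (hyz : y ≠ z) :
      Function.Injective ![x, y, z] := by
    intro i j hij
    fin_cases i <;> fin_cases j <;> simp_all
  have hrange (x y z : V) : ({s((none : Option V), some x), s((none : Option V), some y),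
      s((none : Option V), some z)} : Set (Sym2 (Option V))) =
      Set.range fun i => s((none : Option V), some (![x, y, z] i)) := by
    ext e
    simp [Fin.exists_fin_succ, eq_comm]
  rw [hrange, hrange]
  refine threeEdgeColorable_iff_capGraph (S := A) hcubic (hinj ha12 ha13 ha23)
    (hinj hb12 hb13 hb23) (fun u v hu hv => ?_) ?_ ?_
  · have hmem : G.Adj u v ↔ s(u, v) ∈ crossingEdges G A :=
      ⟨fun h => ⟨h, u, v, rfl, hu, hv⟩, fun h => h.1⟩
    have hne {x y : V} (hx : x ∈ A) : ¬(u = y ∧ v = x) := fun h => hv (h.2 ▸ hx)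
    simp [hmem, hcross, Fin.exists_fin_succ, hne ha₁, hne ha₂, hne ha₃]
  · simp [Fin.forall_fin_succ, ha₁, ha₂, ha₃]
  · simp [Fin.forall_fin_succ, hb₁, hb₂, hb₃]
end

section
/- Let G be a finite simple graph having five distinct, pairwise nonadjacent vertices u₁, …, u₅, each of degree 1, with every other vertex of G of degree 3; for 1 ≤ l ≤ 5 let f_l denote the unique edge of G incident with u_l. Suppose κ is a proper 3-edge-coloring of G and i ≠ j are indices in {1,…,5} such that for three pairwise distinct colors a, b, c one has κ(f_i) = a, κ(f_j) = b, and κ(f_l) = c for every l ∉ {i, j}. Then there exist an index k ∉ {i, j}, a proper 3-edge-coloring κ̂ of G, and pairwise distinct colors a′, b′, c′ such that κ̂(f_i) = a′, κ̂(f_k) = b′, and κ̂(f_l) = c′ for every l ∉ {i, k}. -/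
open Classical in
/-- In a finite connected graph with all degrees at most two, a vertex of degree one has exactly
one partner of degree one. -/
theorem SimpleGraph.Connected.exists_other_leaf {W : Type*} [Fintype W] {K : SimpleGraph W}
    (hK : K.Connected) (h2 : ∀ x, K.degree x ≤ 2) {v : W} (hv : K.degree v = 1) :
    ∃ w, w ≠ v ∧ K.degree w = 1 ∧ ∀ x, K.degree x ≤ 1 → x = v ∨ x = w := by
  obtain ⟨y, hy⟩ := (K.degree_pos_iff_exists_adj v).1 (by omega)
  have : Nontrivial W := ⟨v, y, hy.ne⟩
  have hpos : ∀ x, 0 < K.degree x := fun x => hK.preconnected.degree_pos_of_nontrivial x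
  set L : Finset W := Finset.univ.filter fun x => K.degree x = 1 with hL
  have hsum : ∑ x, K.degree x + L.card = 2 * Fintype.card W := by
    rw [hL, Finset.card_filter, ← Finset.sum_add_distrib, mul_comm, ← smul_eq_mul,
      ← Finset.card_univ, ← Finset.sum_const]
    refine Finset.sum_congr rfl fun x _ => ?_
    have := hpos x
    have := h2 x
    split_ifs <;> omega
  have hedge := hK.card_vert_le_card_edgeSet_add_one
  rw [Nat.card_eq_fintype_card, Nat.card_eq_fintype_card, ← SimpleGraph.edgeFinset_card] at hedge
  rw [K.sum_degrees_eq_twice_card_edges] at hsum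
  have hvL : v ∈ L := by simp [hL, hv]
  have hLpos : 0 < L.card := Finset.card_pos.2 ⟨v, hvL⟩
  have hcard : (L.erase v).card = 1 := by
    rw [Finset.card_erase_of_mem hvL]
    omega
  obtain ⟨w, hw⟩ := Finset.card_eq_one.1 hcard
  have hmem : ∀ x, (x ≠ v ∧ K.degree x = 1) ↔ x = w := fun x => by
    simpa [hL] using Finset.ext_iff.1 hw x
  obtain ⟨hwv, hw1⟩ := (hmem w).2 rfl
  refine ⟨w, hwv, hw1, fun x hx => ?_⟩
  by_cases hxv : x = v
  · exact Or.inl hxv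
  · exact Or.inr ((hmem x).1 ⟨hxv, le_antisymm hx (hpos x)⟩)

open Classical in
/-- In a finite graph with all degrees at most two, the component of a vertex of degree one
contains exactly one further vertex of degree one, and no isolated vertex. -/
theorem SimpleGraph.exists_reachable_other_leaf {V : Type*} [Fintype V] (H : SimpleGraph V)
    (h2 : ∀ x, H.degree x ≤ 2) {v : V} (hv : H.degree v = 1) :
    ∃ w, w ≠ v ∧ H.Reachable v w ∧ H.degree w = 1 ∧
      ∀ x, H.Reachable v x → H.degree x ≤ 1 → x = v ∨ x = w := by
  set D := H.connectedComponentMk v with hD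
  have hmem : ∀ x, x ∈ D.supp ↔ H.Reachable v x := fun x => by
    rw [SimpleGraph.ConnectedComponent.mem_supp_iff, hD, SimpleGraph.ConnectedComponent.eq]
    exact SimpleGraph.reachable_comm
  have hdeg : ∀ x : D.supp, (H.induce D.supp).degree x = H.degree x := fun x =>
    SimpleGraph.degree_induce_of_neighborSet_subset fun y hy =>
      (D.mem_supp_congr_adj hy).1 x.2
  have hconn : (H.induce D.supp).Connected := D.connected_toSimpleGraph
  obtain ⟨w, hwv, hw1, hw⟩ := hconn.exists_other_leaf (v := ⟨v, (hmem v).2 (.refl v)⟩)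
    (fun x => (hdeg x).trans_le (h2 x)) ((hdeg _).trans hv)
  refine ⟨w, fun h => hwv (Subtype.ext h), (hmem w).1 w.2, (hdeg w).symm.trans hw1,
    fun x hx hx1 => ?_⟩
  have := hw ⟨x, (hmem x).2 hx⟩ ((hdeg _).trans_le hx1)
  simpa [Subtype.ext_iff] using this

open Classical in
/-- Exchange the colors `p` and `q` on all edges meeting `S`. -/
noncomputable def kempeSwap {V C : Type*} [DecidableEq C] (κ : Sym2 V → C) (S : Set V)
    (p q : C) (e : Sym2 V) : C :=
  if ∃ v ∈ e, v ∈ S then Equiv.swap p q (κ e) else κ e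

open Classical in
/-- When no edge colored `p` or `q` leaves `S`, the swapped color of an edge can be read off at
either endpoint. -/
theorem kempeSwap_apply {V C : Type*} [DecidableEq C] {G : SimpleGraph V}
    {κ : Sym2 V → C} {S : Set V} {p q : C}
    (hS : ∀ x y, G.Adj x y → (κ s(x, y) = p ∨ κ s(x, y) = q) → (x ∈ S ↔ y ∈ S))
    {e : Sym2 V} (he : e ∈ G.edgeSet) {v : V} (hv : v ∈ e) :
    kempeSwap κ S p q e = if v ∈ S then Equiv.swap p q (κ e) else κ e := by
  obtain ⟨w, rfl⟩ := Sym2.mem_iff_exists.1 hv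
  by_cases hpq : κ s(v, w) = p ∨ κ s(v, w) = q
  · have := hS v w he hpq
    simp [kempeSwap, this]
  · rw [not_or] at hpq
    simp [kempeSwap, Equiv.swap_apply_of_ne_of_ne hpq.1 hpq.2]

theorem ProperEdgeColoring.kempeSwap {V C : Type*} [DecidableEq C] {G : SimpleGraph V}
    {κ : Sym2 V → C} (hκ : ProperEdgeColoring G κ) {S : Set V} {p q : C}
    (hS : ∀ x y, G.Adj x y → (κ s(x, y) = p ∨ κ s(x, y) = q) → (x ∈ S ↔ y ∈ S)) :
    ProperEdgeColoring G (kempeSwap κ S p q) := by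
  rintro e₁ h₁ e₂ h₂ hne ⟨v, hv₁, hv₂⟩
  have := hκ e₁ h₁ e₂ h₂ hne ⟨v, hv₁, hv₂⟩
  rw [kempeSwap_apply hS h₁ hv₁, kempeSwap_apply hS h₂ hv₂]
  split_ifs
  · exact (Equiv.injective _).ne this
  · exact this

theorem ProperEdgeColoring.injOn_neighborSet {V C : Type*} {G : SimpleGraph V} {κ : Sym2 V → C}
    (hκ : ProperEdgeColoring G κ) (v : V) :
    Set.InjOn (fun w => κ s(v, w)) (G.neighborSet v) := by
  intro x hx y hy hxy
  by_contra hne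
  exact hκ s(v, x) hx s(v, y) hy (fun h => hne (Sym2.congr_right.1 h)) ⟨v, by simp, by simp⟩ hxy

/-- The subgraph of the edges of `G` not colored `a`. -/
def avoidColor {V C : Type*} (G : SimpleGraph V) (κ : Sym2 V → C) (a : C) : SimpleGraph V where
  Adj x y := G.Adj x y ∧ κ s(x, y) ≠ a
  symm := ⟨fun x y h => ⟨h.1.symm, by rw [Sym2.eq_swap]; exact h.2⟩⟩
  loopless := ⟨fun x h => h.1.ne rfl⟩

open Classical in
theorem ProperEdgeColoring.degree_avoidColor_lt {V C : Type*} [Fintype V] [Fintype C]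
    {G : SimpleGraph V} {κ : Sym2 V → C} (hκ : ProperEdgeColoring G κ) (a : C) (v : V) :
    (avoidColor G κ a).degree v < Fintype.card C := by
  rw [← SimpleGraph.card_neighborFinset_eq_degree, ← Finset.card_univ,
    ← Finset.card_erase_add_one (Finset.mem_univ a), Nat.lt_add_one_iff]
  refine Finset.card_le_card_of_injOn (fun w => κ s(v, w)) (fun w hw => ?_) fun x hx y hy => ?_
  · simp only [Finset.mem_coe, SimpleGraph.mem_neighborFinset] at hw
    simpa using hw.2
  · simp only [Finset.mem_coe, SimpleGraph.mem_neighborFinset] at hx hy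
    exact hκ.injOn_neighborSet v hx.1 hy.1

open Classical in
theorem ProperEdgeColoring.degree_le_degree_avoidColor_add_one {V C : Type*} [Fintype V]
    {G : SimpleGraph V} {κ : Sym2 V → C} (hκ : ProperEdgeColoring G κ) (a : C) (v : V) :
    G.degree v ≤ (avoidColor G κ a).degree v + 1 := by
  have hone : ((G.neighborFinset v).filter fun w => κ s(v, w) = a).card ≤ 1 := by
    refine Finset.card_le_one.2 fun x hx y hy => ?_
    simp only [Finset.mem_filter, SimpleGraph.mem_neighborFinset] at hx hy
    exact hκ.injOn_neighborSet v hx.1 hy.1 (hx.2.trans hy.2.symm)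
  have hrest : (avoidColor G κ a).neighborFinset v =
      (G.neighborFinset v).filter fun w => ¬ κ s(v, w) = a := by
    ext w
    simp only [SimpleGraph.mem_neighborFinset, Finset.mem_filter]
    rfl
  rw [← SimpleGraph.card_neighborFinset_eq_degree, ← SimpleGraph.card_neighborFinset_eq_degree,
    hrest, ← Finset.card_filter_add_card_filter_not (s := G.neighborFinset v)
      (fun w => κ s(v, w) = a)]
  omega


/-- Let `G` be a finite simple graph with five distinct pairwise nonadjacent vertices
`u 0, …, u 4`, each of degree 1, all other vertices having degree 3, and let `f l` be the
unique edge incident with `u l`.  If `κ` is a proper 3-edge-coloring of `G` and `i ≠ j` are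
such that for pairwise distinct colors `a, b, c` we have `κ (f i) = a`, `κ (f j) = b` and
`κ (f l) = c` for all `l ∉ {i, j}`, then there are an index `k ∉ {i, j}`, a proper
3-edge-coloring `κ'` of `G` and pairwise distinct colors `a', b', c'` with
`κ' (f i) = a'`, `κ' (f k) = b'` and `κ' (f l) = c'` for all `l ∉ {i, k}`. -/
theorem kempe_ring_recoloring {V : Type*} [Fintype V] [DecidableEq V]
    (G : SimpleGraph V) [DecidableRel G.Adj]
    (u : Fin 5 → V) (hu : Function.Injective u)
    (hdeg1 : ∀ l : Fin 5, G.degree (u l) = 1)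
    (hnadj : ∀ l m : Fin 5, l ≠ m → ¬ G.Adj (u l) (u m))
    (hdeg3 : ∀ v : V, (∀ l : Fin 5, v ≠ u l) → G.degree v = 3)
    (f : Fin 5 → Sym2 V)
    (hf : ∀ l : Fin 5, f l ∈ G.edgeSet ∧ u l ∈ f l)
    (κ : Sym2 V → Fin 3) (hκ : ProperEdgeColoring G κ)
    (i j : Fin 5) (hij : i ≠ j)
    (a b c : Fin 3) (hab : a ≠ b) (hac : a ≠ c) (hbc : b ≠ c)
    (hfi : κ (f i) = a) (hfj : κ (f j) = b)
    (hrest : ∀ l : Fin 5, l ≠ i → l ≠ j → κ (f l) = c) :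
    ∃ k : Fin 5, k ≠ i ∧ k ≠ j ∧
      ∃ κ' : Sym2 V → Fin 3, ProperEdgeColoring G κ' ∧
        ∃ a' b' c' : Fin 3, a' ≠ b' ∧ a' ≠ c' ∧ b' ≠ c' ∧
          κ' (f i) = a' ∧ κ' (f k) = b' ∧
          ∀ l : Fin 5, l ≠ i → l ≠ k → κ' (f l) = c' := by
  classical
  set H := avoidColor G κ a with hH
  have hle : ∀ v, H.degree v ≤ G.degree v := fun v =>
    SimpleGraph.degree_le_of_le (fun _ _ h => h.1)
  have hj1 : H.degree (u j) = 1 := by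
    refine le_antisymm ((hle _).trans_eq (hdeg1 j)) ((H.degree_pos_iff_exists_adj _).2 ?_)
    obtain ⟨w, hw⟩ := Sym2.mem_iff_exists.1 (hf j).2
    refine ⟨w, ?_, ?_⟩
    · rw [← SimpleGraph.mem_edgeSet, ← hw]
      exact (hf j).1
    · rw [← hw, hfj]
      exact hab.symm
  obtain ⟨w, hwj, hreach, hw1, hw⟩ := H.exists_reachable_other_leaf
    (fun x => Nat.lt_succ_iff.1 (hκ.degree_avoidColor_lt a x)) hj1
  obtain ⟨k, rfl⟩ : ∃ k, w = u k := by
    by_contra! hne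
    have h3 := hdeg3 w hne
    have hw2 := hκ.degree_le_degree_avoidColor_add_one a w
    rw [← hH, hw1] at hw2
    have : G.degree w ≤ 2 := by convert hw2
    omega
  have hki : k ≠ i := by
    rintro rfl
    obtain ⟨x, hx, hxa⟩ := (H.degree_pos_iff_exists_adj _).1 (hw1 ▸ Nat.one_pos)
    obtain ⟨y, hy⟩ := Sym2.mem_iff_exists.1 (hf k).2
    have hyadj : G.Adj (u k) y := by
      rw [← SimpleGraph.mem_edgeSet, ← hy]
      exact (hf k).1
    obtain rfl := (SimpleGraph.degree_eq_one_iff_existsUnique_adj.1 (hdeg1 k)).unique hx hyadj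
    exact hxa (hy ▸ hfi)
  have hkj : k ≠ j := fun h => hwj (h ▸ rfl)
  set S : Set V := {x | H.Reachable (u j) x}
  have hS : ∀ x y, G.Adj x y → (κ s(x, y) = b ∨ κ s(x, y) = c) → (x ∈ S ↔ y ∈ S) := by
    intro x y hxy hbc'
    have hadj : H.Adj x y := ⟨hxy, by rcases hbc' with h | h <;> rw [h] <;> tauto⟩
    exact ⟨fun h => h.trans hadj.reachable, fun h => h.trans hadj.symm.reachable⟩
  have happ := fun l => kempeSwap_apply hS (hf l).1 (hf l).2
  refine ⟨k, hki, hkj, kempeSwap κ S b c, hκ.kempeSwap hS, a, b, c, hab, hac, hbc, ?_, ?_, ?_⟩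
  · rw [happ, hfi, Equiv.swap_apply_of_ne_of_ne hab hac, ite_self]
  · rw [happ, if_pos (show u k ∈ S from hreach), hrest k hki hkj, Equiv.swap_apply_right]
  · intro l hli hlk
    rw [happ]
    by_cases hlj : l = j
    · subst hlj
      rw [if_pos (show u l ∈ S from .refl _), hfj, Equiv.swap_apply_left]
    · rw [if_neg, hrest l hli hlj]
      intro hl
      rcases hw (u l) hl ((hle _).trans_eq (hdeg1 l)) with h | h
      · exact hlj (hu h)
      · exact hlk (hu h)
end

section
/- Fix an integer k ≥ 1, let 𝒞* be the set of all parity colorings of {1,…,k}, let 𝒞₀ ⊆ 𝒞*, and let 𝒞₁, 𝒞₂, … be the levels defined from 𝒞₀ by the level construction. Then the set 𝒞′ := 𝒞* ∖ ⋃_{i≥0} 𝒞ᵢ is consistent and contains every consistent subset of 𝒞* ∖ 𝒞₀; moreover, if t is the smallest index with 𝒞_t = ∅, then all levels 𝒞_s with s ≥ t are empty, so 𝒞′ = 𝒞* ∖ (𝒞₀ ∪ 𝒞₁ ∪ … ∪ 𝒞_t). In particular 𝒞′ is the maximal consistent subset of 𝒞* ∖ 𝒞₀. -/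
/-- A coloring `κ : Fin k → Fin 3` satisfies the parity condition if the sizes of the
three color classes are pairwise congruent modulo 2. -/
def ParityColoring {k : ℕ} (κ : Fin k → Fin 3) : Prop :=
  ({e | κ e = 0} : Set (Fin k)).ncard % 2 = ({e | κ e = 1} : Set (Fin k)).ncard % 2 ∧
  ({e | κ e = 1} : Set (Fin k)).ncard % 2 = ({e | κ e = 2} : Set (Fin k)).ncard % 2

/-- Two matches `{a,b}` and `{c,d}` with `a < c < b < d` overlap
(stated symmetrically in the two matches). -/
def Overlap {k : ℕ} (m m' : Sym2 (Fin k)) : Prop :=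
  ∃ a b c d : Fin k, a < c ∧ c < b ∧ b < d ∧
    ((m = s(a, b) ∧ m' = s(c, d)) ∨ (m = s(c, d) ∧ m' = s(a, b)))

/-- A projective signed matching: a set of signed matches (a match is an unordered pair of
distinct elements of `Fin k`, a sign is a `Bool` with `true` standing for `+1`) whose
underlying matches are pairwise disjoint and which can be partitioned into a part `A₀` of
matches overlapping no other underlying match and a part `A₁` of pairwise overlapping
matches. -/
def ProjSignedMatching {k : ℕ} (M : Set (Sym2 (Fin k) × Bool)) : Prop :=
  (∀ p ∈ M, ¬ p.1.IsDiag) ∧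
  (∀ p ∈ M, ∀ q ∈ M, p ≠ q → ∀ x : Fin k, x ∈ p.1 → x ∉ q.1) ∧
  (∃ A₀ A₁ : Set (Sym2 (Fin k)),
    A₀ ∪ A₁ = {m | ∃ μ, (m, μ) ∈ M} ∧ A₀ ∩ A₁ = ∅ ∧
    (∀ m ∈ A₀, ∀ m' : Sym2 (Fin k), (∃ μ, (m', μ) ∈ M) → m' ≠ m → ¬ Overlap m m') ∧
    (∀ m ∈ A₁, ∀ m' ∈ A₁, m ≠ m' → Overlap m m'))

/-- A coloring `κ` `θ`-fits a projective signed matching `M` if the elements covered by the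
matches of `M` are exactly those `e` with `κ e ≠ θ`, and a match carries the sign `+1`
exactly when its two elements receive the same color. -/
def ThetaFits {k : ℕ} (κ : Fin k → Fin 3) (θ : Fin 3)
    (M : Set (Sym2 (Fin k) × Bool)) : Prop :=
  (∀ x : Fin k, (∃ p ∈ M, x ∈ p.1) ↔ κ x ≠ θ) ∧
  (∀ p ∈ M, ∀ e f : Fin k, p.1 = s(e, f) → (κ e = κ f ↔ p.2 = true))

/-- A set `𝒞` of parity colorings is consistent if for every `κ ∈ 𝒞` and every color `θ`
there is a projective signed matching `M` such that `κ` `θ`-fits `M` and every parity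
coloring that `θ`-fits `M` belongs to `𝒞`. -/
def Consistent {k : ℕ} (𝒞 : Set (Fin k → Fin 3)) : Prop :=
  (∀ κ ∈ 𝒞, ParityColoring κ) ∧
  ∀ κ ∈ 𝒞, ∀ θ : Fin 3, ∃ M : Set (Sym2 (Fin k) × Bool),
    ProjSignedMatching M ∧ ThetaFits κ θ M ∧
    ∀ κ' : Fin k → Fin 3, ParityColoring κ' → ThetaFits κ' θ M → κ' ∈ 𝒞

/-- A set of even size in a finite linear order is covered by pairwise disjoint,
pairwise non-overlapping matches. -/
theorem exists_noncrossing_matching {k : ℕ} (n : ℕ) :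
    ∀ S : Finset (Fin k), S.card = 2 * n →
      ∃ A : Set (Sym2 (Fin k)), (∀ m ∈ A, ¬ m.IsDiag) ∧
        (∀ m ∈ A, ∀ m' ∈ A, m ≠ m' → ∀ x, x ∈ m → x ∉ m') ∧
        (∀ x, (∃ m ∈ A, x ∈ m) ↔ x ∈ S) ∧
        (∀ m ∈ A, ∀ m' ∈ A, ¬ Overlap m m') := by
  induction n with
  | zero =>
    intro S hS
    have hS' : S = ∅ := by simpa using hS
    subst hS'
    exact ⟨∅, by simp⟩
  | succ n ih =>
    intro S hS
    have hne : S.Nonempty := by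
      rw [← Finset.card_pos]; omega
    have ha : S.min' hne ∈ S := S.min'_mem hne
    have hcard : (S.erase (S.min' hne)).card = 2 * n + 1 := by
      rw [Finset.card_erase_of_mem ha]; omega
    have hmin : ∀ x ∈ S, S.min' hne ≤ x := fun x hx => S.min'_le x hx
    generalize S.min' hne = a at ha hcard hmin
    have hne' : (S.erase a).Nonempty := by
      rw [← Finset.card_pos]; omega
    have hb : (S.erase a).min' hne' ∈ S.erase a := Finset.min'_mem _ hne'
    have hcard' : ((S.erase a).erase ((S.erase a).min' hne')).card = 2 * n := by
      rw [Finset.card_erase_of_mem hb]; omega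
    have hmin' : ∀ x ∈ S.erase a, (S.erase a).min' hne' ≤ x :=
      fun x hx => Finset.min'_le _ x hx
    generalize (S.erase a).min' hne' = b at hb hcard' hmin'
    obtain ⟨hba, hbS⟩ := Finset.mem_erase.1 hb
    have hab : a < b := lt_of_le_of_ne (hmin b hbS) (Ne.symm hba)
    obtain ⟨A, hdiag, hdisj, hcov, hover⟩ := ih _ hcard'
    have hgt : ∀ m ∈ A, ∀ x ∈ m, b < x := by
      intro m hm x hx
      have h := (hcov x).1 ⟨m, hm, hx⟩
      obtain ⟨hxb, hxS⟩ := Finset.mem_erase.1 h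
      exact lt_of_le_of_ne (hmin' x hxS) (Ne.symm hxb)
    have hfresh : ∀ m ∈ A, ∀ x ∈ s(a, b), x ∉ m := by
      intro m hm x hx hxm
      have h := hgt m hm x hxm
      rcases Sym2.mem_iff.1 hx with rfl | rfl
      · exact absurd h (not_lt.2 hab.le)
      · exact lt_irrefl _ h
    have hside : ∀ m ∈ A, ¬ Overlap s(a, b) m ∧ ¬ Overlap m s(a, b) := by
      intro m hm
      constructor
      all_goals
        rintro ⟨p, q, r, t, hpr, hrq, hqt, ⟨h₁, h₂⟩ | ⟨h₁, h₂⟩⟩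
        all_goals
          have hm' := hgt m hm
          first
            | rw [h₁] at hm'; simp only [Sym2.eq_iff] at h₂
            | rw [h₂] at hm'; simp only [Sym2.eq_iff] at h₁
          simp only [Sym2.mem_iff, forall_eq_or_imp, forall_eq] at hm'
          grind
    have hself : ¬ Overlap s(a, b) s(a, b) := by
      rintro ⟨p, q, r, t, hpr, hrq, hqt, ⟨h₁, h₂⟩ | ⟨h₁, h₂⟩⟩
      all_goals
        simp only [Sym2.eq_iff] at h₁ h₂
        grind
    refine ⟨insert s(a, b) A, ?_, ?_, ?_, ?_⟩
    · rintro m (rfl | hm)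
      · simpa using hab.ne
      · exact hdiag m hm
    · rintro m (rfl | hm) m' (rfl | hm') hmm x hx
      · exact absurd rfl hmm
      · exact hfresh m' hm' x hx
      · exact fun hx' => hfresh m hm x hx' hx
      · exact hdisj m hm m' hm' hmm x hx
    · intro x
      have h := hcov x
      simp only [Set.mem_insert_iff, exists_eq_or_imp, h, Sym2.mem_iff, Finset.mem_erase]
      grind
    · rintro m (rfl | hm) m' (rfl | hm')
      · exact hself
      · exact (hside m' hm').1
      · exact (hside m hm).2
      · exact hover m hm m' hm'

/-- In a parity coloring, the number of elements not colored `θ` is even. -/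
theorem ParityColoring.even_card_ne {k : ℕ} {κ : Fin k → Fin 3} (h : ParityColoring κ)
    (θ : Fin 3) : Even (Finset.univ.filter fun e => κ e ≠ θ).card := by
  have key : ∀ i j : Fin 3, i ≠ j → i ≠ θ → j ≠ θ →
      (Finset.univ.filter fun e => κ e ≠ θ).card =
        (Finset.univ.filter fun e => κ e = i).card +
          (Finset.univ.filter fun e => κ e = j).card := by
    intro i j hij hi hj
    rw [← Finset.card_union_of_disjoint]
    · congr 1
      ext e
      simp only [Finset.mem_filter, Finset.mem_univ, true_and, Finset.mem_union]
      omega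
    · rw [Finset.disjoint_filter]
      rintro e - rfl
      exact hij
  simp only [ParityColoring, Set.ncard_eq_toFinset_card', Set.toFinset_ofPred] at h
  rw [Nat.even_iff]
  obtain rfl | rfl | rfl : θ = 0 ∨ θ = 1 ∨ θ = 2 := by omega
  · have := key 1 2 (by decide) (by decide) (by decide)
    omega
  · have := key 0 2 (by decide) (by decide) (by decide)
    omega
  · have := key 0 1 (by decide) (by decide) (by decide)
    omega

/-- Every parity coloring `θ`-fits some projective signed matching. -/
theorem ParityColoring.exists_thetaFits {k : ℕ} {κ : Fin k → Fin 3} (h : ParityColoring κ)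
    (θ : Fin 3) : ∃ M : Set (Sym2 (Fin k) × Bool), ProjSignedMatching M ∧ ThetaFits κ θ M := by
  obtain ⟨n, hn⟩ := (h.even_card_ne θ).two_dvd
  obtain ⟨A, hdiag, hdisj, hcov, hover⟩ := exists_noncrossing_matching n _ hn
  have hsign : ∀ m : Sym2 (Fin k), ∃ μ : Bool, μ = true ↔ (m.map κ).IsDiag := by
    intro m
    by_cases hm : (m.map κ).IsDiag
    · exact ⟨true, by simpa using hm⟩
    · exact ⟨false, by simpa using hm⟩
  choose μ hμ using hsign
  refine ⟨{p | p.1 ∈ A ∧ p.2 = μ p.1}, ⟨?_, ?_, A, ∅, ?_, ?_, ?_, ?_⟩, ?_, ?_⟩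
  · exact fun p hp => hdiag p.1 hp.1
  · rintro ⟨m, ν⟩ ⟨hm, hν : ν = μ m⟩ ⟨m', ν'⟩ ⟨hm', hν' : ν' = μ m'⟩ hne
    subst hν hν'
    refine hdisj m hm m' hm' ?_
    rintro rfl
    exact hne rfl
  · ext m
    simp
  · simp
  · rintro m hm m' ⟨_, hm', -⟩ -
    exact hover m hm m' hm'
  · simp
  · intro x
    simpa using hcov x
  · rintro ⟨m, ν⟩ ⟨-, hν : ν = μ m⟩ e f (rfl : m = s(e, f))
    subst hν
    simpa using (hμ s(e, f)).symm

/-- The level construction: level `0` is `𝒞₀`, and for `i ≥ 1` level `i` consists of those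
parity colorings `κ` lying in no earlier level for which there is a `θ` such that every
projective signed matching that `κ` `θ`-fits admits a parity coloring that `θ`-fits it and
lies in an earlier level.  The set `𝒞' := 𝒞* \ ⋃ᵢ 𝒞ᵢ` is consistent and contains every
consistent subset of `𝒞* \ 𝒞₀` (hence is the maximal consistent subset of `𝒞* \ 𝒞₀`);
moreover if `t` is the smallest index with `level t = ∅` then all later levels are empty,
so `𝒞' = 𝒞* \ (𝒞₀ ∪ ⋯ ∪ 𝒞_t)`. -/
theorem maximal_consistent_subset (k : ℕ) (hk : 1 ≤ k)
    (𝒞₀ : Set (Fin k → Fin 3)) (h𝒞₀ : ∀ κ ∈ 𝒞₀, ParityColoring κ)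
    (level : ℕ → Set (Fin k → Fin 3))
    (hlevel0 : level 0 = 𝒞₀)
    (hlevelsucc : ∀ i : ℕ, level (i + 1) =
      {κ | ParityColoring κ ∧ (∀ j ≤ i, κ ∉ level j) ∧
        ∃ θ : Fin 3, ∀ M : Set (Sym2 (Fin k) × Bool),
          ProjSignedMatching M → ThetaFits κ θ M →
            ∃ κ' : Fin k → Fin 3, ParityColoring κ' ∧ ThetaFits κ' θ M ∧
              ∃ j ≤ i, κ' ∈ level j}) :
    Consistent ({κ | ParityColoring κ} \ ⋃ i : ℕ, level i) ∧
    (∀ 𝒟 : Set (Fin k → Fin 3), 𝒟 ⊆ {κ | ParityColoring κ} \ 𝒞₀ → Consistent 𝒟 →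
      𝒟 ⊆ {κ | ParityColoring κ} \ ⋃ i : ℕ, level i) ∧
    (∀ t : ℕ, level t = ∅ → (∀ s < t, level s ≠ ∅) →
      (∀ s : ℕ, t ≤ s → level s = ∅) ∧
      ({κ | ParityColoring κ} \ ⋃ i : ℕ, level i) =
        {κ | ParityColoring κ} \ ⋃ i ∈ Set.Iic t, level i) := by
  have hparity : ∀ i, ∀ κ ∈ level i, ParityColoring κ := by
    rintro (_ | i) κ hκ
    · exact h𝒞₀ κ (hlevel0 ▸ hκ)
    · rw [hlevelsucc] at hκ
      exact hκ.1
  refine ⟨⟨fun κ hκ => hκ.1, ?_⟩, ?_, ?_⟩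
  · rintro κ ⟨hκ, hκlevel⟩ θ
    simp only [Set.mem_iUnion, not_exists] at hκlevel
    have hex : ∀ i, ∃ M : Set (Sym2 (Fin k) × Bool), ProjSignedMatching M ∧ ThetaFits κ θ M ∧
        ∀ κ', ParityColoring κ' → ThetaFits κ' θ M → ∀ j ≤ i, κ' ∉ level j := by
      intro i
      by_contra! hcon
      refine hκlevel (i + 1) ?_
      rw [hlevelsucc]
      exact ⟨hκ, fun j _ => hκlevel j, θ, hcon⟩
    choose M hM hfit hlate using hex
    obtain ⟨N, hN⟩ := Finite.exists_infinite_fiber M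
    refine ⟨N, ?_, ?_, ?_⟩
    · obtain ⟨i, hi⟩ := (Set.infinite_coe_iff.1 hN).nonempty
      exact hi ▸ hM i
    · obtain ⟨i, hi⟩ := (Set.infinite_coe_iff.1 hN).nonempty
      exact hi ▸ hfit i
    · intro κ' hκ' hfit'
      refine ⟨hκ', ?_⟩
      simp only [Set.mem_iUnion, not_exists]
      intro j
      obtain ⟨i, hi, hji⟩ := (Set.infinite_coe_iff.1 hN).exists_gt j
      have hi' : M i = N := hi
      exact hlate i κ' hκ' (hi' ▸ hfit') j hji.le
  · intro 𝒟 h𝒟 hcons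
    have hout : ∀ i, ∀ κ ∈ 𝒟, κ ∉ level i := by
      intro i
      induction i using Nat.strong_induction_on with
      | _ i ih =>
        intro κ hκ hκi
        cases i with
        | zero => exact (h𝒟 hκ).2 (hlevel0 ▸ hκi)
        | succ i =>
          rw [hlevelsucc] at hκi
          obtain ⟨-, -, θ, hθ⟩ := hκi
          obtain ⟨M, hM, hfit, hclosed⟩ := hcons.2 κ hκ θ
          obtain ⟨κ', hκ', hfit', j, hj, hκ'j⟩ := hθ M hM hfit
          exact ih j (Nat.lt_succ_of_le hj) κ' (hclosed κ' hκ' hfit') hκ'j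
    intro κ hκ
    refine ⟨(h𝒟 hκ).1, ?_⟩
    simp only [Set.mem_iUnion, not_exists]
    exact fun i => hout i κ hκ
  · intro t ht _
    have hempty : ∀ s, t ≤ s → level s = ∅ := by
      intro s
      induction s using Nat.strong_induction_on with
      | _ s ih =>
        intro hts
        rcases hts.eq_or_lt with rfl | hlt
        · exact ht
        obtain ⟨s, rfl⟩ := Nat.exists_eq_succ_of_ne_zero (Nat.ne_zero_of_lt hlt)
        rw [Set.eq_empty_iff_forall_notMem]
        intro κ hκ
        rw [Nat.succ_eq_add_one, hlevelsucc] at hκ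
        obtain ⟨hκ, hκearly, θ, hθ⟩ := hκ
        have hθ' : ∀ M : Set (Sym2 (Fin k) × Bool), ProjSignedMatching M → ThetaFits κ θ M →
            ∃ κ', ParityColoring κ' ∧ ThetaFits κ' θ M ∧ ∃ j < t, κ' ∈ level j := by
          intro M hM hfit
          obtain ⟨κ', hκ', hfit', j, hj, hκ'j⟩ := hθ M hM hfit
          refine ⟨κ', hκ', hfit', j, ?_, hκ'j⟩
          by_contra! htj
          rw [ih j (Nat.lt_succ_of_le hj) htj] at hκ'j
          exact hκ'j
        cases t with
        | zero =>
          obtain ⟨M, hM, hfit⟩ := hκ.exists_thetaFits θ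
          obtain ⟨_, _, _, j, hj, _⟩ := hθ' M hM hfit
          exact Nat.not_lt_zero j hj
        | succ i =>
          have hmem : κ ∈ level (i + 1) := by
            rw [hlevelsucc]
            refine ⟨hκ, fun j hj => hκearly j (by omega), θ, ?_⟩
            simpa only [Nat.lt_succ_iff] using hθ'
          rw [ht] at hmem
          exact hmem
    refine ⟨hempty, ?_⟩
    congr 1
    ext κ
    simp only [Set.mem_iUnion, Set.mem_Iic, exists_prop]
    constructor
    · rintro ⟨i, hi⟩
      refine ⟨i, ?_, hi⟩
      by_contra! hti
      rw [hempty i hti.le] at hi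
      exact hi
    · rintro ⟨i, -, hi⟩
      exact ⟨i, hi⟩
end

section
/- Let k be an integer with 3 ≤ k ≤ 7 and let ≈ be an equivalence relation on ℤ/kℤ such that (i) no two cyclically adjacent elements are equivalent, i.e. i ≈ i+1 holds for no i, and (ii) ≈ is noncrossing, i.e. there are no elements with representatives 0 ≤ a < b < c < d < k such that a ≈ c, b ≈ d, and a is not equivalent to b. Then k minus the number of equivalence classes of ≈ is at most ⌊k/2⌋ − 1, and for each such k there is an equivalence relation satisfying (i) and (ii) attaining this bound. -/
open Finset in
open scoped Classical in
/-- The elements of a finite linear order that are not least in their class account for all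
identifications. -/
theorem Setoid.card_sub_card_quotient_le {α : Type*} [LinearOrder α] [Fintype α] (s : Setoid α) :
    Fintype.card α - Nat.card (Quotient s) ≤ #{i : α | ∃ j < i, s j i} := by
  have h : #{i : α | ¬ ∃ j < i, s j i} ≤ Nat.card (Quotient s) := by
    rw [Nat.card_eq_fintype_card, ← Finset.card_univ]
    refine card_le_card_of_injOn (fun i => (⟦i⟧ : Quotient s)) (by simp) ?_
    intro a ha b hb hab
    have hab : s a b := Quotient.exact hab
    simp only [coe_filter, mem_univ, true_and, Set.mem_ofPred_eq, not_exists, not_and] at ha hb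
    rcases lt_trichotomy a b with h | h | h
    · exact absurd hab (hb a h)
    · exact h
    · exact absurd (s.symm hab) (ha b h)
  have := card_filter_add_card_filter_not (s := (univ : Finset α)) (fun i => ∃ j < i, s j i)
  rw [Finset.card_univ] at this
  omega

open Finset in
/-- A noncrossing equivalence relation on a cycle of length `n + 1` without equivalent cyclically
adjacent elements makes at most `⌊(n + 1) / 2⌋ - 1` identifications. -/
theorem Setoid.card_identifications_le_of_noncrossing {n : ℕ} (s : Setoid (Fin (n + 1)))
    (hadj : ∀ i, ¬ s i (i + 1))
    (hnc : ∀ a b c d : Fin (n + 1), a < b → b < c → c < d → s a c → s b d → s a b) :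
    n + 1 - Nat.card (Quotient s) ≤ (n + 1) / 2 - 1 := by
  classical
  set S : Finset (Fin (n + 1)) := {i | ∃ j > i, s j i} with hS
  set E : Finset (Fin (n + 1)) := {i | ∃ j < i + 1, s j (i + 1)} with hE
  have hcardS : n + 1 - Nat.card (Quotient s) ≤ #S := by
    have := Setoid.card_sub_card_quotient_le (α := (Fin (n + 1))ᵒᵈ) s
    rw [Fintype.card_orderDual, Fintype.card_fin] at this
    refine this.trans (card_le_card fun i hi => ?_)
    exact mem_filter.2 ⟨mem_univ (α := Fin (n + 1)) i, (mem_filter.1 hi).2⟩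
  have hcardE : n + 1 - Nat.card (Quotient s) ≤ #E := by
    have := Setoid.card_sub_card_quotient_le s
    rw [Fintype.card_fin] at this
    refine this.trans (card_le_card_of_injOn (fun i => i - 1) ?_ (sub_left_injective.injOn))
    intro i hi
    simpa [hE] using hi
  have hsucc (i : Fin (n + 1)) (hi : i ≠ Fin.last n) : (i + 1).val = i.val + 1 :=
    Fin.val_add_one_of_lt (Fin.lt_last_iff_ne_last.2 hi)
  have hdisj : Disjoint S E := by
    rw [Finset.disjoint_left]
    intro i hiS hiE
    obtain ⟨j, hj, hji⟩ : ∃ j > i, s j i := by simpa [hS] using hiS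
    obtain ⟨l, hl, hli⟩ : ∃ l < i + 1, s l (i + 1) := by simpa [hE] using hiE
    have hi : i ≠ Fin.last n := (hj.trans_le (Fin.le_last j)).ne
    have h1 := hsucc i hi
    have hl' : l ≠ i := by rintro rfl; exact hadj _ hli
    have hj' : j ≠ i + 1 := by rintro rfl; exact hadj _ (s.symm hji)
    have := hnc l i (i + 1) j (by grind) (by grind) (by grind) hli (s.symm hji)
    exact hadj i (s.trans (s.symm this) hli)
  obtain ⟨m, hm0, hm⟩ : ∃ m, s 0 m ∧ ∀ j, s 0 j → j ≤ m := by
    obtain ⟨m, h1, h2⟩ := exists_max_image ({j | s 0 j} : Finset (Fin (n + 1))) id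
      ⟨0, by simp⟩
    exact ⟨m, by simpa using h1, by simpa using h2⟩
  have hmlast : m ≠ Fin.last n := by
    rintro rfl
    exact hadj (Fin.last n) (by simpa using s.symm hm0)
  have hmS : m ∉ S := by
    simp only [hS, mem_filter, mem_univ, true_and, not_exists, not_and]
    intro j hj hjm
    exact (hm j (s.trans hm0 (s.symm hjm))).not_gt hj
  have hmE : m ∉ E := by
    simp only [hE, mem_filter, mem_univ, true_and, not_exists, not_and]
    intro l hl hlm
    have h1 := hsucc m hmlast
    have hl' : l ≠ m := by rintro rfl; exact hadj _ hlm
    have h0l : s 0 l := by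
      rcases eq_or_ne l 0 with rfl | h0
      · exact s.refl 0
      · exact hnc 0 l m (m + 1) (Fin.pos_iff_ne_zero.2 h0) (by grind) (by grind) hm0 hlm
    exact hadj m (s.trans (s.trans (s.symm hm0) h0l) hlm)
  have hlastS : Fin.last n ∉ S := by
    simp only [hS, mem_filter, mem_univ, true_and, not_exists, not_and]
    intro j hj
    exact absurd hj (Fin.le_last j).not_gt
  have hlastE : Fin.last n ∉ E := by simp [hE]
  have hsub : S ∪ E ⊆ univ \ {m, Fin.last n} := by
    intro i hi
    simp only [mem_sdiff, mem_univ, mem_insert, mem_singleton, true_and]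
    rcases mem_union.1 hi with hi | hi <;> rintro (rfl | rfl) <;> contradiction
  have hcard := card_le_card hsub
  rw [card_union_of_disjoint hdisj, card_sdiff_of_subset (subset_univ _), card_pair hmlast,
    card_univ, Fintype.card_fin] at hcard
  omega

/-- Collapses the even residues other than `k - 1` to `0` and fixes all other residues. -/
def ZMod.collapseEven (k : ℕ) (i : ZMod k) : ZMod k :=
  if i.val % 2 = 0 ∧ i.val + 1 < k then 0 else i

theorem ZMod.eq_of_collapseEven_eq {k : ℕ} {i j : ZMod k} (hij : i ≠ j)
    (h : ZMod.collapseEven k i = ZMod.collapseEven k j) : ZMod.collapseEven k i = 0 := by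
  unfold ZMod.collapseEven at *
  split_ifs at * <;> simp_all

theorem Setoid.natCard_quotient_ker {α β : Type*} [Fintype α] [DecidableEq β] (f : α → β) :
    Nat.card (Quotient (Setoid.ker f)) = (Finset.univ.image f).card := by
  rw [Nat.card_congr (Setoid.quotientKerEquivRange f), ← Set.image_univ, ← Finset.coe_univ,
    ← Finset.coe_image, Nat.card_eq_card_toFinset, Finset.toFinset_coe]


/-- Let `3 ≤ k ≤ 7` and let `≈` be an equivalence relation on `ℤ/kℤ` such that no two
cyclically adjacent elements are equivalent and `≈` is noncrossing (there are no elements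
with representatives `0 ≤ a < b < c < d < k` with `a ≈ c`, `b ≈ d` and `a` not equivalent
to `b`).  Then `k` minus the number of equivalence classes of `≈` is at most `⌊k/2⌋ - 1`,
and for each such `k` this bound is attained by some equivalence relation satisfying the
two conditions. -/
theorem cycle_identifications_bound (k : ℕ) (hk3 : 3 ≤ k) (hk7 : k ≤ 7) :
    (∀ s : Setoid (ZMod k),
      (∀ i : ZMod k, ¬ s.r i (i + 1)) →
      (¬ ∃ a b c d : ZMod k, a.val < b.val ∧ b.val < c.val ∧ c.val < d.val ∧
        s.r a c ∧ s.r b d ∧ ¬ s.r a b) →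
      k - Nat.card (Quotient s) ≤ k / 2 - 1) ∧
    (∃ s : Setoid (ZMod k),
      (∀ i : ZMod k, ¬ s.r i (i + 1)) ∧
      (¬ ∃ a b c d : ZMod k, a.val < b.val ∧ b.val < c.val ∧ c.val < d.val ∧
        s.r a c ∧ s.r b d ∧ ¬ s.r a b) ∧
      k - Nat.card (Quotient s) = k / 2 - 1) := by
  constructor
  · intro s hadj hnc
    obtain ⟨n, rfl⟩ : ∃ n, k = n + 1 := ⟨k - 1, by omega⟩
    refine Setoid.card_identifications_le_of_noncrossing (n := n) s hadj ?_
    intro a b c d hab hbc hcd hac hbd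
    by_contra h
    exact hnc ⟨a, b, c, d, hab, hbc, hcd, hac, hbd, h⟩
  · refine ⟨Setoid.ker (ZMod.collapseEven k), ?_, ?_, ?_⟩
    · change ∀ i, ¬ ZMod.collapseEven k i = ZMod.collapseEven k (i + 1)
      interval_cases k <;> decide
    · rintro ⟨a, b, c, d, hab, hbc, hcd, hac, hbd, h⟩
      have hac' : a ≠ c := by rintro rfl; omega
      have hbd' : b ≠ d := by rintro rfl; omega
      exact h ((ZMod.eq_of_collapseEven_eq hac' hac).trans
        (ZMod.eq_of_collapseEven_eq hbd' hbd).symm)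
    · interval_cases k <;> rw [Setoid.natCard_quotient_ker] <;> decide
end

section
/- Let V be a finite vertex set, let x ≠ y be elements of V, and let G₁ and G₂ be finite simple graphs on V such that xy is an edge of both G₁ and G₂ and xy is the only edge belonging to both G₁ and G₂. If G₁ and G₂ each admit a nowhere-zero ℤ₂×ℤ₂-flow, then the union graph G₁ ∪ G₂ (whose edge set is the union of the two edge sets) admits a nowhere-zero ℤ₂×ℤ₂-flow, and so does the graph obtained from G₁ ∪ G₂ by deleting the edge xy. -/
/-- A nowhere-zero `ℤ₂ × ℤ₂`-flow on a simple graph `G`: a function on edges that is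
nonzero on every edge of `G` and sums to zero over the edges incident with each vertex. -/
def NowhereZero4Flow {V : Type*} (G : SimpleGraph V)
    (f : Sym2 V → ZMod 2 × ZMod 2) : Prop :=
  (∀ e ∈ G.edgeSet, f e ≠ 0) ∧ ∀ v : V, ∑ᶠ e ∈ G.incidenceSet v, f e = 0

/-- A sum over the edges of `G` at `v` only depends on the extension by zero off `G`. -/
theorem finsum_incidenceSet_eq_finsum_indicator {V M : Type*} [AddCommMonoid M]
    (G : SimpleGraph V) (f : Sym2 V → M) (v : V) :
    ∑ᶠ e ∈ G.incidenceSet v, f e = ∑ᶠ e ∈ {e : Sym2 V | v ∈ e}, G.edgeSet.indicator f e := by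
  refine finsum_congr fun e => ?_
  by_cases hv : v ∈ e <;> by_cases he : e ∈ G.edgeSet <;>
    simp [SimpleGraph.incidenceSet, hv, he]

/-- The automorphisms of `ℤ₂ × ℤ₂` act transitively on the nonzero elements. -/
theorem exists_addMonoidHom_zmod_two_prod_map_eq {a b : ZMod 2 × ZMod 2}
    (ha : a ≠ 0) (hb : b ≠ 0) :
    ∃ σ : ZMod 2 × ZMod 2 →+ ZMod 2 × ZMod 2, σ a = b ∧ ∀ c, c ≠ 0 → σ c ≠ 0 := by
  have key : ∀ a b : ZMod 2 × ZMod 2, a ≠ 0 → b ≠ 0 → ∃ s t u w : ZMod 2,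
      (s * a.1 + t * a.2, u * a.1 + w * a.2) = b ∧
      ∀ c : ZMod 2 × ZMod 2, c ≠ 0 → (s * c.1 + t * c.2, u * c.1 + w * c.2) ≠ 0 := by
    decide
  obtain ⟨s, t, u, w, hab, hinj⟩ := key a b ha hb
  refine ⟨AddMonoidHom.mk' (fun c => (s * c.1 + t * c.2, u * c.1 + w * c.2)) ?_, hab, hinj⟩
  intro c d
  ext <;> simp <;> ring

/-- Adding the zero extension of one flow to an endomorphic image of another gives a flow on
every graph whose edges are exactly the support of the result. -/
theorem NowhereZero4Flow.indicator_add_map {V : Type*} [Finite V] {G₁ G₂ H : SimpleGraph V}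
    {f₁ f₂ : Sym2 V → ZMod 2 × ZMod 2} (hf₁ : NowhereZero4Flow G₁ f₁)
    (hf₂ : NowhereZero4Flow G₂ f₂) (σ : ZMod 2 × ZMod 2 →+ ZMod 2 × ZMod 2)
    (hH : ∀ e, e ∈ H.edgeSet ↔ G₁.edgeSet.indicator f₁ e + σ (G₂.edgeSet.indicator f₂ e) ≠ 0) :
    NowhereZero4Flow H
      fun e => G₁.edgeSet.indicator f₁ e + σ (G₂.edgeSet.indicator f₂ e) := by
  refine ⟨fun e he => (hH e).1 he, fun v => ?_⟩
  have hfin : {e : Sym2 V | v ∈ e}.Finite := Set.toFinite _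
  rw [finsum_incidenceSet_eq_finsum_indicator,
    Set.indicator_eq_self.2 fun e he => (hH e).2 he, finsum_mem_add_distrib hfin,
    ← AddMonoidHom.map_finsum_mem _ σ hfin, ← finsum_incidenceSet_eq_finsum_indicator,
    ← finsum_incidenceSet_eq_finsum_indicator, hf₁.2 v, hf₂.2 v, map_zero, add_zero]

/-- Flow gluing along a 2-sum: if `G₁` and `G₂` are finite simple graphs on the same vertex
set whose only common edge is `xy` (with `x ≠ y`), and each admits a nowhere-zero
`ℤ₂ × ℤ₂`-flow, then so does their union, and so does the union with the edge `xy`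
deleted. -/
theorem flow_two_sum {V : Type*} [Fintype V] [DecidableEq V]
    (x y : V) (hxy : x ≠ y)
    (G₁ G₂ : SimpleGraph V)
    (h₁ : G₁.Adj x y) (h₂ : G₂.Adj x y)
    (hcommon : G₁.edgeSet ∩ G₂.edgeSet = {s(x, y)})
    (hf₁ : ∃ f, NowhereZero4Flow G₁ f) (hf₂ : ∃ f, NowhereZero4Flow G₂ f) :
    (∃ f, NowhereZero4Flow (G₁ ⊔ G₂) f) ∧
    (∃ f, NowhereZero4Flow ((G₁ ⊔ G₂).deleteEdges {s(x, y)}) f) := by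
  obtain ⟨f₁, hf₁⟩ := hf₁
  obtain ⟨f₂, hf₂⟩ := hf₂
  have ha : f₁ s(x, y) ≠ 0 := hf₁.1 _ h₁
  have hb : f₂ s(x, y) ≠ 0 := hf₂.1 _ h₂
  have hmem (e : Sym2 V) : e ∈ G₁.edgeSet ∧ e ∈ G₂.edgeSet ↔ e = s(x, y) :=
    Set.ext_iff.1 hcommon e
  constructor
  · obtain ⟨b, hb0, hne⟩ : ∃ b : ZMod 2 × ZMod 2, b ≠ 0 ∧ f₁ s(x, y) + b ≠ 0 := by
      generalize f₁ s(x, y) = a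
      revert a
      decide
    obtain ⟨σ, hσ, hinj⟩ := exists_addMonoidHom_zmod_two_prod_map_eq hb hb0
    refine ⟨_, hf₁.indicator_add_map hf₂ σ fun e => ?_⟩
    have := hmem e
    have := hf₁.1 e
    have := fun h => hinj _ (hf₂.1 e h)
    by_cases he₁ : e ∈ G₁.edgeSet <;> by_cases he₂ : e ∈ G₂.edgeSet <;>
      simp_all [SimpleGraph.edgeSet_sup]
  · obtain ⟨σ, hσ, hinj⟩ := exists_addMonoidHom_zmod_two_prod_map_eq hb ha
    have hself : f₁ s(x, y) + f₁ s(x, y) = 0 := CharTwo.add_self_eq_zero _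
    refine ⟨_, hf₁.indicator_add_map hf₂ σ fun e => ?_⟩
    have := hmem e
    have := hf₁.1 e
    have := fun h => hinj _ (hf₂.1 e h)
    by_cases he₁ : e ∈ G₁.edgeSet <;> by_cases he₂ : e ∈ G₂.edgeSet <;>
      simp_all [SimpleGraph.edgeSet_sup, SimpleGraph.edgeSet_deleteEdges]
end
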